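/- arXiv:2105.07203 — 4 statements merged into one kernel-verified Lean document; each statement's English description precedes it below -/
import Mathlib

section
/- Let D ⊆ ℤ be a finite nonempty set and let T ⊆ ℤ \ {0} be a finite set of nonzero integers. Then the union of D with all its translates by elements of T satisfies |D ∪ ⋃_{t ∈ T} (D + t)| ≥ |D| + |T|. (Auxiliary claim in the proof of the paper's Lemma 3: the union of the translated copies 'stretches' at least |D| + |t̂| elements, where t̂ is the set of distinct nonzero offsets.) -/
open scoped Pointwise in
/-- A set together with its translates by the elements of `T` is a sumset. -/
theorem union_biUnion_translates_eq_add_insert_zero (D T : Finset ℤ) :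
    (D ∪ T.biUnion fun t => D.image (· + t)) = D + insert 0 T := by
  ext x
  simp only [Finset.mem_union, Finset.mem_biUnion, Finset.mem_image, Finset.mem_add,
    Finset.mem_insert]
  constructor
  · rintro (h | ⟨t, ht, d, hd, rfl⟩)
    · exact ⟨x, h, 0, Or.inl rfl, add_zero x⟩
    · exact ⟨d, hd, t, Or.inr ht, rfl⟩
  · rintro ⟨d, hd, t, rfl | ht, rfl⟩
    · exact Or.inl (by simpa using hd)
    · exact Or.inr ⟨t, ht, d, hd, rfl⟩

/-- Auxiliary claim in the proof of the paper's Lemma 3: for a finite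
nonempty `D ⊆ ℤ` and a finite set `T` of nonzero integers, the union of `D`
with all of its translates by elements of `T` has at least `|D| + |T|`
elements. -/
theorem union_translates_card_ge
    (D : Finset ℤ) (hD : D.Nonempty) (T : Finset ℤ) (hT : 0 ∉ T) :
    D.card + T.card ≤ (D ∪ T.biUnion fun t => D.image (· + t)).card := by
  have h := cauchy_davenport_add_of_linearOrder_isCancelAdd hD (Finset.insert_nonempty 0 T)
  rw [Finset.card_insert_of_notMem hT] at h
  rw [union_biUnion_translates_eq_add_insert_zero]
  exact h
end

section
/- Let d ≥ 1 and n ≥ 1. Let D^1, …, D^d be finite nonempty subsets of ℤ and set D = D^1 × ⋯ × D^d ⊆ ℤ^d. Let t_1, …, t_n ∈ ℤ^d be translation vectors with t_1 = 0, and for each dimension i let t̂^i = {t_k^i : 1 ≤ k ≤ n} \ {0} be the set of distinct nonzero i-th coordinates of the translation vectors. Assume |t̂^i| ≤ |D^i| for every i. Then the union of the translated copies satisfies |⋃_{k=1}^{n} (D + t_k)| ≥ 2 ∏_{i=1}^{d} |D^i| − ∏_{i=1}^{d} (|D^i| − |t̂^i|). (Paper's Lemma 3: lower bound on the access set size of a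 simple overlap access during a rectangular subcomputation.) -/
/-- Translates of a nonempty finite set `A` of integers by a finite set `T` of nonzero integers
reach at least `|T|` points outside `A`. -/
theorem exists_disjoint_translates_card_eq (A T : Finset ℤ) (hA : A.Nonempty) (hT : 0 ∉ T) :
    ∃ O : Finset ℤ, Disjoint O A ∧ O.card = T.card ∧ ∀ o ∈ O, ∃ p ∈ T, ∃ e ∈ A, e + p = o := by
  have hmm : A.min' hA ≤ A.max' hA := A.min'_le _ (A.max'_mem hA)
  refine ⟨T.image fun p => (if 0 < p then A.max' hA else A.min' hA) + p, ?_, ?_, ?_⟩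
  · rw [Finset.disjoint_left]
    intro o ho hoA
    obtain ⟨p, hp, rfl⟩ := Finset.mem_image.1 ho
    have hp0 : p ≠ 0 := fun h => hT (h ▸ hp)
    have h1 := A.min'_le _ hoA
    have h2 := A.le_max' _ hoA
    split_ifs at h1 h2 <;> omega
  · refine Finset.card_image_of_injective _ fun p q hpq => ?_
    split_ifs at hpq <;> omega
  · intro o ho
    obtain ⟨p, hp, rfl⟩ := Finset.mem_image.1 ho
    refine ⟨p, hp, _, ?_, rfl⟩
    split_ifs
    exacts [A.max'_mem hA, A.min'_mem hA]

/-- A lower bound on the part of the translated box `D + s` inside the hyperplane `y i = o` that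
avoids `O j` in every coordinate `j < i`. -/
theorem prod_le_card_translate_slice {d : ℕ} (D O : Fin d → Finset ℤ) (s : Fin d → ℤ)
    (hO : ∀ j, (O j).card ≤ (D j).card) (i : Fin d) (o : ℤ) (ho : ∃ e ∈ D i, e + s i = o) :
    (∏ j with j < i, (((D j).card : ℤ) - (O j).card)) * ∏ j with i < j, ((D j).card : ℤ) ≤
      ((((Fintype.piFinset D).image (· + s)).filter
        fun y => (∀ j < i, y j ∉ O j) ∧ y i = o).card : ℤ) := by
  let E : Fin d → Finset ℤ := fun j =>
    if j < i then (D j).image (· + s j) \ O j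
    else if i < j then (D j).image (· + s j) else {o}
  have hcard : ∀ j, ((D j).image (· + s j)).card = (D j).card := fun j =>
    Finset.card_image_of_injective _ (add_left_injective _)
  have hsub : Fintype.piFinset E ⊆ ((Fintype.piFinset D).image (· + s)).filter
      fun y => (∀ j < i, y j ∉ O j) ∧ y i = o := by
    intro y hy
    rw [Fintype.mem_piFinset] at hy
    have hyi : y i = o := by simpa [E] using hy i
    refine Finset.mem_filter.2 ⟨Finset.mem_image.2 ⟨y - s, ?_, sub_add_cancel _ _⟩, ?_, hyi⟩
    · rw [Fintype.mem_piFinset]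
      intro j
      have key : ∃ e ∈ D j, e + s j = y j := by
        rcases lt_trichotomy j i with h | rfl | h
        · have := hy j
          simp only [E, if_pos h, Finset.mem_sdiff, Finset.mem_image] at this
          exact this.1
        · rwa [hyi]
        · have := hy j
          simpa only [E, if_neg h.not_gt, if_pos h, Finset.mem_image] using this
      obtain ⟨e, he, hey⟩ := key
      rwa [Pi.sub_apply, ← hey, add_sub_cancel_right]
    · intro j h
      have := hy j
      simp only [E, if_pos h, Finset.mem_sdiff] at this
      exact this.2
  refine le_trans ?_ (Int.ofNat_le.2 (Finset.card_le_card hsub))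
  rw [Fintype.card_piFinset, Finset.prod_filter, Finset.prod_filter, ← Finset.prod_mul_distrib]
  push_cast
  refine Finset.prod_le_prod (fun j _ => ?_) fun j _ => ?_
  · have := hO j
    refine mul_nonneg ?_ ?_ <;> split_ifs <;> omega
  · have h1 := Finset.le_card_sdiff (O j) ((D j).image (· + s j))
    rw [hcard] at h1
    rcases lt_trichotomy j i with h | rfl | h
    · simp only [E, if_pos h, if_neg h.not_gt]
      omega
    · simp [E]
    · simp only [E, if_pos h, if_neg h.not_gt, hcard, one_mul, le_refl]


/-- **Paper's Lemma 3.** Let `D = D^1 × ⋯ × D^d ⊆ ℤ^d` be a product of finite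
nonempty sets, and let `t_1 = 0, t_2, …, t_n ∈ ℤ^d` be translation vectors.
For each dimension `i`, let `t̂^i` be the set of distinct nonzero `i`-th
coordinates of the translation vectors, and assume `|t̂^i| ≤ |D^i|`. Then
`|⋃_k (D + t_k)| ≥ 2 ∏_i |D^i| − ∏_i (|D^i| − |t̂^i|)`. -/
theorem simple_overlap_access_set_lower_bound
    (d n : ℕ) (hd : 1 ≤ d) (hn : 1 ≤ n)
    (D : Fin d → Finset ℤ) (hD : ∀ i, (D i).Nonempty)
    (t : Fin n → Fin d → ℤ) (ht0 : t ⟨0, hn⟩ = 0)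
    (htD : ∀ i, ((Finset.univ.image fun k : Fin n => t k i).erase 0).card ≤
      (D i).card) :
    2 * ∏ i, ((D i).card : ℤ) -
        ∏ i, (((D i).card : ℤ) -
          ((Finset.univ.image fun k : Fin n => t k i).erase 0).card) ≤
      (((Finset.univ.biUnion fun k : Fin n =>
        (Fintype.piFinset D).image (· + t k)).card : ℤ)) := by
  have hn0 : ∀ i, (0 : ℤ) ∉ (Finset.univ.image fun k : Fin n => t k i).erase 0 := fun i =>
    Finset.notMem_erase _ _
  choose O hOD hOc hOt using fun i => exists_disjoint_translates_card_eq (D i) _ (hD i) (hn0 i)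
  simp only [← hOc] at htD ⊢
  set U := Finset.univ.biUnion fun k : Fin n => (Fintype.piFinset D).image (· + t k) with hU
  let S : Fin d → Finset (Fin d → ℤ) := fun i => U.filter fun y => (∀ j < i, y j ∉ O j) ∧ y i ∈ O i
  have hS : ∀ i, ((O i).card : ℤ) * (∏ j with j < i, (((D j).card : ℤ) - (O j).card)) *
      ∏ j with i < j, ((D j).card : ℤ) ≤ (S i).card := by
    intro i
    have hmaps : (S i : Set (Fin d → ℤ)).MapsTo (fun y => y i) (O i) := fun y hy =>
      (Finset.mem_filter.1 (Finset.mem_coe.1 hy)).2.2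
    rw [Finset.card_eq_sum_card_fiberwise hmaps, mul_assoc, ← nsmul_eq_mul, Nat.cast_sum]
    refine Finset.card_nsmul_le_sum _ _ _ fun o ho => ?_
    obtain ⟨p, hp, e, he, heo⟩ := hOt i o ho
    obtain ⟨k, -, rfl⟩ := Finset.mem_image.1 (Finset.mem_of_mem_erase hp)
    refine (prod_le_card_translate_slice D O (t k) htD i o ⟨e, he, heo⟩).trans
      (Int.ofNat_le.2 (Finset.card_le_card fun y hy => ?_))
    obtain ⟨hy, hlt, hyo⟩ := Finset.mem_filter.1 hy
    exact Finset.mem_filter.2 ⟨Finset.mem_filter.2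
      ⟨Finset.mem_biUnion.2 ⟨k, Finset.mem_univ _, hy⟩, hlt, hyo ▸ ho⟩, hyo⟩
  have hdisj : ∀ i j, i < j → Disjoint (S i) (S j) := fun i j hij =>
    Finset.disjoint_left.2 fun y hi hj =>
      (Finset.mem_filter.1 hj).2.1 i hij (Finset.mem_filter.1 hi).2.2
  have hSc : (Finset.univ.biUnion S).card = ∑ i, (S i).card :=
    Finset.card_biUnion fun i _ j _ hij =>
      hij.lt_or_gt.elim (hdisj i j) fun h => (hdisj j i h).symm
  have hDS : Disjoint (Fintype.piFinset D) (Finset.univ.biUnion S) := by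
    refine Finset.disjoint_left.2 fun y hy hyS => ?_
    obtain ⟨i, -, hi⟩ := Finset.mem_biUnion.1 hyS
    exact Finset.disjoint_left.1 (hOD i) (Finset.mem_filter.1 hi).2.2 (Fintype.mem_piFinset.1 hy i)
  have hsub : Fintype.piFinset D ∪ Finset.univ.biUnion S ⊆ U := by
    refine Finset.union_subset (fun y hy => ?_)
      (Finset.biUnion_subset.2 fun i _ => Finset.filter_subset _ _)
    exact Finset.mem_biUnion.2 ⟨⟨0, hn⟩, Finset.mem_univ _,
      Finset.mem_image.2 ⟨y, hy, by rw [ht0, add_zero]⟩⟩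
  have hcard := Finset.card_le_card hsub
  rw [Finset.card_union_of_disjoint hDS, hSc, Fintype.card_piFinset] at hcard
  have hsum := Finset.sum_le_sum fun i (_ : i ∈ Finset.univ) => hS i
  rw [Finset.prod_sub_ordered]
  zify at hcard
  linarith
end

section
/- Let d ≥ 1 and n ≥ 1. Let D^1, …, D^d be finite nonempty subsets of ℤ and set D = D^1 × ⋯ × D^d ⊆ ℤ^d. Let t_1, …, t_n ∈ ℤ^d be translation vectors with t_1 = 0, and for each dimension i let t̂^i = {t_k^i : 1 ≤ k ≤ n} \ {0}. Assume |t̂^i| ≤ |D^i| for every i. Then |⋃_{k=1}^{n} (D + t_k)| − ∏_{i=1}^{d} |D^i| ≥ ∏_{i=1}^{d} |D^i| − ∏_{i=1}^{d} (|D^i| − |t̂^i|); that is, even after discounting ∏_{i=1}^{d} |D^i| elements that could be computed rather than loaded, at least ∏_{i=1}^{d} |D^i| − ∏_{i=1}^{d} (|D^i| − |t̂^i|) elements of the union must be accessed from outside. (Paper's Corollary 1: access set lower bound when the output array overlaps with an input array.) -/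
open Finset in
/-- A union of translates of `∏ i, D i` contains many points having a coordinate in `E i` for some
`i ∈ I`, provided every element of `E i` is reached by translating `D i`. -/
theorem prod_card_le_card_filter_biUnion_add_prod {ι κ G : Type*} [Fintype ι] [DecidableEq ι]
    [Fintype κ] [AddGroup G] [DecidableEq G] (D E : ι → Finset G) (t : κ → ι → G)
    (hE : ∀ i, ∀ e ∈ E i, ∃ k, ∃ x ∈ D i, x + t k i = e)
    (hcard : ∀ i, #(E i) ≤ #(D i)) (I : Finset ι) :
    ∏ i, #(D i) ≤
      #{x ∈ univ.biUnion fun k => (Fintype.piFinset D).image (· + t k) | ∃ i ∈ I, x i ∈ E i} +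
        ∏ i, (if i ∈ I then #(D i) - #(E i) else #(D i)) := by
  induction I using Finset.induction_on with
  | empty => simp
  | insert a I ha ih =>
    set U := univ.biUnion fun k => (Fintype.piFinset D).image (· + t k)
    set Q := ∏ i ∈ univ.erase a, (if i ∈ I then #(D i) - #(E i) else #(D i))
    have hI : ∏ i, (if i ∈ I then #(D i) - #(E i) else #(D i)) = #(D a) * Q := by
      rw [← mul_prod_erase univ _ (mem_univ a), if_neg ha]
    have hI' : ∏ i, (if i ∈ insert a I then #(D i) - #(E i) else #(D i)) =
        (#(D a) - #(E a)) * Q := by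
      rw [← mul_prod_erase univ _ (mem_univ a), if_pos (mem_insert_self a I)]
      congr 1
      refine prod_congr rfl fun i hi => ?_
      simp [mem_insert, ne_of_mem_erase hi]
    set N := {x ∈ U | x a ∈ E a ∧ ∀ i ∈ I, x i ∉ E i} with hN
    have hsplit : #{x ∈ U | ∃ i ∈ I, x i ∈ E i} + #N ≤ #{x ∈ U | ∃ i ∈ insert a I, x i ∈ E i} := by
      rw [← card_union_of_disjoint]
      · refine card_le_card fun x hx => ?_
        simp only [hN, mem_union, mem_filter, mem_insert, exists_eq_or_imp] at hx ⊢
        tauto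
      · refine disjoint_left.2 fun x hx hx' => ?_
        obtain ⟨i, hi, hxi⟩ := (mem_filter.1 hx).2
        exact (mem_filter.1 hx').2.2 i hi hxi
    have hnew : #(E a) * Q ≤ #N := by
      rw [card_eq_sum_card_fiberwise (s := N) (f := fun x : ι → G => x a) (t := E a)
        fun x hx => (mem_filter.1 hx).2.1, ← smul_eq_mul]
      refine card_nsmul_le_sum _ _ _ fun e he => ?_
      obtain ⟨k, y, hy, hye⟩ := hE a e he
      let B : ι → Finset G := fun i => if i = a then {e} else
        if i ∈ I then (D i).image (· + t k i) \ E i else (D i).image (· + t k i)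
      have hB : Q ≤ #(Fintype.piFinset B) := by
        rw [Fintype.card_piFinset, ← mul_prod_erase univ _ (mem_univ a)]
        simp only [B, if_true, card_singleton, one_mul]
        refine prod_le_prod' fun i hi => ?_
        have himage : #((D i).image (· + t k i)) = #(D i) :=
          card_image_of_injective _ (add_left_injective _)
        rw [if_neg (ne_of_mem_erase hi)]
        split_ifs
        · exact himage ▸ le_card_sdiff _ _
        · exact himage.ge
      refine hB.trans (card_le_card fun x hx => ?_)
      rw [Fintype.mem_piFinset] at hx
      have hxa : x a = e := by simpa [B] using hx a
      have hxD : ∀ i, x i ∈ (D i).image (· + t k i) := fun i => by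
        have := hx i
        by_cases hia : i = a
        · subst hia
          exact mem_image.2 ⟨y, hy, hye.trans hxa.symm⟩
        · simp only [B, if_neg hia] at this
          split_ifs at this
          · exact (mem_sdiff.1 this).1
          · exact this
      refine mem_filter.2 ⟨mem_filter.2 ⟨?_, hxa ▸ he, fun i hi => ?_⟩, hxa⟩
      · refine mem_biUnion.2 ⟨k, mem_univ k, mem_image.2 ⟨x - t k, ?_, sub_add_cancel _ _⟩⟩
        refine Fintype.mem_piFinset.2 fun i => ?_
        obtain ⟨z, hz, hzx⟩ := mem_image.1 (hxD i)
        simpa [← hzx] using hz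
      · have := hx i
        simp only [B, if_neg (ne_of_mem_of_not_mem hi ha), if_pos hi] at this
        exact (mem_sdiff.1 this).2
    have hQa : (#(D a) - #(E a)) * Q + #(E a) * Q = #(D a) * Q := by
      rw [← add_mul, Nat.sub_add_cancel (hcard a)]
    rw [hI] at ih
    rw [hI']
    omega

open Finset Pointwise in
/-- Translating a finite set of integers by the elements of `T ∋ 0` produces at least as many new
elements as `T` has nonzero elements. -/
theorem exists_subset_add_sdiff_card_eq_card_erase {D T : Finset ℤ} (hD : D.Nonempty)
    (hT : 0 ∈ T) : ∃ E ⊆ (D + T) \ D, #E = #(T.erase 0) := by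
  refine exists_subset_card_eq ?_
  have h := cauchy_davenport_add_of_linearOrder_isCancelAdd hD ⟨0, hT⟩
  have hsub : D ⊆ D + T := fun x hx => by simpa using add_mem_add hx hT
  rw [card_erase_of_mem hT, card_sdiff_of_subset hsub]
  omega

/-- **Paper's Corollary 1.** In the input-output simple overlap setting, with
`D = D^1 × ⋯ × D^d ⊆ ℤ^d` a product of finite nonempty sets, translation
vectors `t_1 = 0, t_2, …, t_n ∈ ℤ^d`, access offset sets
`t̂^i = {t_k^i} \ {0}` satisfying `|t̂^i| ≤ |D^i|`, even after discounting the
`∏_i |D^i|` elements that could be computed rather than loaded, at least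
`∏_i |D^i| − ∏_i (|D^i| − |t̂^i|)` elements of `⋃_k (D + t_k)` remain. -/
theorem input_output_access_set_lower_bound
    (d n : ℕ) (hd : 1 ≤ d) (hn : 1 ≤ n)
    (D : Fin d → Finset ℤ) (hD : ∀ i, (D i).Nonempty)
    (t : Fin n → Fin d → ℤ) (ht0 : t ⟨0, hn⟩ = 0)
    (htD : ∀ i, ((Finset.univ.image fun k : Fin n => t k i).erase 0).card ≤
      (D i).card) :
    ∏ i, ((D i).card : ℤ) -
        ∏ i, (((D i).card : ℤ) -
          ((Finset.univ.image fun k : Fin n => t k i).erase 0).card) ≤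
      (((Finset.univ.biUnion fun k : Fin n =>
        (Fintype.piFinset D).image (· + t k)).card : ℤ)) -
        ∏ i, ((D i).card : ℤ) := by
  have hT : ∀ i, (0 : ℤ) ∈ Finset.univ.image fun k : Fin n => t k i := fun i =>
    Finset.mem_image.2 ⟨⟨0, hn⟩, Finset.mem_univ _, congrFun ht0 i⟩
  choose E hEsub hEcard using fun i => exists_subset_add_sdiff_card_eq_card_erase (hD i) (hT i)
  have hEreach : ∀ i, ∀ e ∈ E i, ∃ k, ∃ x ∈ D i, x + t k i = e := fun i e he => by
    obtain ⟨x, hx, s, hs, hxs⟩ := Finset.mem_add.1 (Finset.mem_sdiff.1 (hEsub i he)).1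
    obtain ⟨k, -, rfl⟩ := Finset.mem_image.1 hs
    exact ⟨k, x, hx, hxs⟩
  have hcount := prod_card_le_card_filter_biUnion_add_prod D E t hEreach
    (fun i => (hEcard i).trans_le (htD i)) Finset.univ
  simp only [Finset.mem_univ, true_and, if_true, hEcard] at hcount
  set U := Finset.univ.biUnion fun k : Fin n => (Fintype.piFinset D).image (· + t k)
  have hsplit : (U.filter fun x => ∃ i, x i ∈ E i).card + ∏ i, (D i).card ≤ U.card := by
    rw [← Fintype.card_piFinset, ← Finset.card_union_of_disjoint]
    · refine Finset.card_le_card (Finset.union_subset (Finset.filter_subset _ _) fun x hx => ?_)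
      exact Finset.mem_biUnion.2 ⟨⟨0, hn⟩, Finset.mem_univ _,
        Finset.mem_image.2 ⟨x, hx, by simp [ht0]⟩⟩
    · refine Finset.disjoint_left.2 fun x hx hxD => ?_
      obtain ⟨i, hi⟩ := (Finset.mem_filter.1 hx).2
      exact (Finset.mem_sdiff.1 (hEsub i hi)).2 (Fintype.mem_piFinset.1 hxD i)
  have hcast : ∏ i, (((D i).card : ℤ) -
      ((Finset.univ.image fun k : Fin n => t k i).erase 0).card) =
      ((∏ i, ((D i).card - ((Finset.univ.image fun k : Fin n => t k i).erase 0).card) : ℕ) : ℤ) := by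
    rw [Nat.cast_prod]
    exact Finset.prod_congr rfl fun i _ => (Nat.cast_sub (htD i)).symm
  rw [hcast, ← Nat.cast_prod]
  omega
end

section
/- Let ℓ ≥ 1, let D^1, …, D^ℓ be finite nonempty sets, and let H be a nonempty subset of D^1 × ⋯ × D^ℓ. Let Ψ_1, …, Ψ_m ⊆ {1, …, ℓ} be coordinate-index subsets and let π_{Ψ_j}(H) denote the projection of H onto the coordinates in Ψ_j. Then |H| · ∑_{j=1}^{m} ∏_{i ∈ Ψ_j} |D^i| ≤ (∏_{t=1}^{ℓ} |D^t|) · ∑_{j=1}^{m} |π_{Ψ_j}(H)|. Equivalently, the ratio δ(H) = |H| / ∑_{j=1}^{m} |π_{Ψ_j}(H)| is maximized, among all subcomputations H with subcomputation domain D^1 × ⋯ × D^ℓ, by the rectangular subcomputation H_rec = D^1 × ⋯ × D^ℓ, for which δ(H_rec) = ∏_{t=1}^{ℓ} |D^t| / ∑_{j=1}^{m} ∏_{i ∈ Ψ_j} |D^i|. (Paper's Lemma 4: the rectangular subcomputation maximizes the ratio of subcomputation size to dominator set size.) -/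
/-- A finite subset of a box has at most as many points as its projection onto the coordinates
in `S` times the product of the remaining side lengths. -/
theorem card_le_card_image_restrict_mul_prod_compl {ι : Type*} [Fintype ι] [DecidableEq ι]
    {α : ι → Type*} [∀ i, DecidableEq (α i)] {D : ∀ i, Finset (α i)}
    {H : Finset (∀ i, α i)} (hH : H ⊆ Fintype.piFinset D) (S : Finset ι) :
    H.card ≤ (H.image fun x => fun i : {i // i ∈ S} => x i.1).card *
      ∏ i ∈ Sᶜ, (D i).card := by
  have hcompl : (Fintype.piFinset fun i : {i // i ∈ Sᶜ} => D i.1).card =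
      ∏ i ∈ Sᶜ, (D i).card := by
    rw [Fintype.card_piFinset]
    exact Finset.prod_coe_sort Sᶜ fun i => (D i).card
  rw [← hcompl, ← Finset.card_product]
  refine Finset.card_le_card_of_injOn (fun x => (fun i => x i.1, fun i => x i.1)) ?_ ?_
  · intro x hx
    have hxD := Fintype.mem_piFinset.mp (hH hx)
    exact Finset.mem_product.mpr ⟨Finset.mem_image_of_mem _ hx,
      Fintype.mem_piFinset.mpr fun i => hxD i.1⟩
  · intro x _ y _ hxy
    obtain ⟨h₁, h₂⟩ := Prod.mk.inj hxy
    funext i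
    by_cases hi : i ∈ S
    · exact congrFun h₁ ⟨i, hi⟩
    · exact congrFun h₂ ⟨i, Finset.mem_compl.mpr hi⟩


/-- **Paper's Lemma 4.** For a nonempty `H ⊆ D^1 × ⋯ × D^ℓ` (all `D^t` finite
and nonempty) and coordinate-index subsets `Ψ_1, …, Ψ_m`,
`|H| ⋅ ∑_j ∏_{i ∈ Ψ_j} |D^i| ≤ (∏_t |D^t|) ⋅ ∑_j |π_{Ψ_j}(H)|`;
equivalently, the ratio `δ(H) = |H| / ∑_j |π_{Ψ_j}(H)|` is maximized by the
rectangular subcomputation `H_rec = D^1 × ⋯ × D^ℓ`, for which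
`δ(H_rec) = ∏_t |D^t| / ∑_j ∏_{i ∈ Ψ_j} |D^i|`. -/
theorem rectangular_subcomputation_maximizes_intensity
    (ℓ m : ℕ) (hℓ : 1 ≤ ℓ) (α : Fin ℓ → Type*) [∀ i, DecidableEq (α i)]
    (D : ∀ i, Finset (α i)) (hD : ∀ i, (D i).Nonempty)
    (H : Finset (∀ i, α i)) (hH : H ⊆ Fintype.piFinset D) (hHne : H.Nonempty)
    (Ψ : Fin m → Finset (Fin ℓ)) :
    H.card * ∑ j, ∏ i ∈ Ψ j, (D i).card ≤
      (∏ t, (D t).card) *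
        ∑ j, (H.image fun x => fun i : {i // i ∈ Ψ j} => x i.1).card := by
  rw [Finset.mul_sum, Finset.mul_sum]
  refine Finset.sum_le_sum fun j _ => ?_
  rw [← Finset.prod_mul_prod_compl (Ψ j), mul_comm, mul_assoc, mul_comm (∏ i ∈ (Ψ j)ᶜ, _)]
  exact Nat.mul_le_mul_left _ (card_le_card_image_restrict_mul_prod_compl hH (Ψ j))
end
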